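/- arXiv:2209.00189 — 2 statements merged into one kernel-verified Lean document; each statement's English description precedes it below -/
import Mathlib

section
/- Let K be a finite label set with |K| ≥ 2, let d ≥ 1, and let η > 0 be a learning rate. Fix a majority class j and a minority class r in K with sample counts n_j > 0 and n_r > 0. Let h̄^(r), h̄^(j) ∈ ℝ^d be the class-mean feature vectors with h̄^(r) ≠ 0 and h̄^(r)·h̄^(j) > 0, and let p̄_j^(j), p̄_j^(r) ∈ (0,1) be the class-mean softmax probabilities assigned to class j over samples of class j and of class r respectively. Define the class-mean-approximation SGD update of the classifier weight of class j as Δw_j = η·(n_j·(1 − p̄_j^(j))·h̄^(j) − n_r·p̄_j^(r)·h̄^(r)). Then Δw_j·h̄^(r) > 0 if and only if n_j/n_r > p̄_j^(r)·‖h̄^(r)‖² / ((1 − p̄_j^(j))·(h̄^(r)·h̄^(j))). -/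
open scoped RealInnerProductSpace

/-- Theorem 1 (majority-class part): under the class-mean approximation, the
local SGD update of the majority-class weight satisfies `⟪Δwj, h̄ʳ⟫ > 0` iff
the sample-count ratio `n_j / n_r` exceeds the corresponding bound. -/
theorem deviation_majority
    (K : Type*) [Fintype K] (hK : 2 ≤ Fintype.card K)
    (d : ℕ) (hd : 1 ≤ d)
    (η : ℝ) (hη : 0 < η)
    (j r : K) (nj nr : ℝ) (hnj : 0 < nj) (hnr : 0 < nr)
    (hbar_r hbar_j : EuclideanSpace ℝ (Fin d))
    (hne : hbar_r ≠ 0) (hdot : 0 < ⟪hbar_r, hbar_j⟫)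
    (pjj pjr : ℝ) (hpjj : pjj ∈ Set.Ioo (0:ℝ) 1) (hpjr : pjr ∈ Set.Ioo (0:ℝ) 1)
    (Δwj : EuclideanSpace ℝ (Fin d))
    (hΔwj : Δwj = η • ((nj * (1 - pjj)) • hbar_j - (nr * pjr) • hbar_r)) :
    ⟪Δwj, hbar_r⟫ > 0 ↔
      nj / nr > pjr * ‖hbar_r‖ ^ 2 / ((1 - pjj) * ⟪hbar_r, hbar_j⟫) := by
  have hp : 0 < 1 - pjj := sub_pos.mpr hpjj.2
  have key : ⟪Δwj, hbar_r⟫ =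
      η * (nj * ((1 - pjj) * ⟪hbar_r, hbar_j⟫) - pjr * ‖hbar_r‖ ^ 2 * nr) := by
    rw [hΔwj, real_inner_smul_left, inner_sub_left, real_inner_smul_left,
      real_inner_smul_left, real_inner_self_eq_norm_sq, real_inner_comm hbar_r hbar_j]
    ring
  rw [key, gt_iff_lt, gt_iff_lt, mul_pos_iff_of_pos_left hη, sub_pos,
    div_lt_div_iff₀ (mul_pos hp hdot) hnr]
end

section
/- Let K be a finite label set with |K| ≥ 2, let d ≥ 1, let η > 0, and let τ > 0. Fix a majority class j and a minority class r in K with sample counts n_j > 0 and n_r > 0, and pairwise label margins Δ_{(r,y)} = τ·(n_r^{−1/4} − n_y^{−1/4}) for y ∈ K. Let h̄^(r), h̄^(j) ∈ ℝ^d be the class-mean feature vectors with h̄^(r) ≠ 0 and h̄^(r)·h̄^(j) > 0, let p̃̄_r^(j) > 0 be the class-mean calibrated probability of class r over samples of class j, and let p̃̄_y^(r) ≥ 0 be the class-mean calibrated probabilities over samples of class r, with S := ∑_{y∈K, y≠r} Δ_{(r,y)}·p̃̄_y^(r) > 0. Define the calibrated class-mean update Δw_r = η·(n_r·S·h̄^(r)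 − n_j·p̃̄_r^(j)·h̄^(j)) and the calibrated deviation bound D̃_{jr} = ∑_{y∈K, y≠r} Δ_{(r,y)}·p̃̄_y^(r)·‖h̄^(r)‖² / (p̃̄_r^(j)·(h̄^(r)·h̄^(j))). Then Δw_r·h̄^(r) < 0 if and only if n_j/n_r > D̃_{jr}. -/
open scoped RealInnerProductSpace

/-- Theorem 3 (deviation bound after calibration): with pairwise label margins
`Δ_{(r,y)} = τ (n_r^{−1/4} − n_y^{−1/4})` and class-mean calibrated
probabilities, the calibrated local update of the minority-class weight
deviates (`⟪Δwr, h̄ʳ⟫ < 0`) iff `n_j / n_r` exceeds the calibrated deviation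
bound `D̃_{jr} = ∑_{y≠r} Δ_{(r,y)} p̃̄_y^(r) ‖h̄ʳ‖² / (p̃̄_r^(j) ⟪h̄ʳ, h̄ʲ⟫)`. -/
theorem deviation_after_calibration
    (K : Type*) [Fintype K] [DecidableEq K] (hK : 2 ≤ Fintype.card K)
    (d : ℕ) (hd : 1 ≤ d) (η τ : ℝ) (hη : 0 < η) (hτ : 0 < τ)
    (j r : K) (n : K → ℝ) (hn : ∀ y, 0 < n y)
    (Δ : K → ℝ)
    (hΔ : ∀ y, Δ y = τ * (n r ^ (-(1/4) : ℝ) - n y ^ (-(1/4) : ℝ)))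
    (hbar_r hbar_j : EuclideanSpace ℝ (Fin d))
    (hne : hbar_r ≠ 0) (hdot : 0 < ⟪hbar_r, hbar_j⟫)
    (ptrj : ℝ) (hptrj : 0 < ptrj)
    (pt : K → ℝ) (hpt : ∀ y, 0 ≤ pt y)
    (S : ℝ) (hS : S = ∑ y ∈ Finset.univ.erase r, Δ y * pt y) (hSpos : 0 < S)
    (Δwr : EuclideanSpace ℝ (Fin d))
    (hΔwr : Δwr = η • ((n r * S) • hbar_r - (n j * ptrj) • hbar_j))
    (Dtil : ℝ)
    (hDtil : Dtil = ∑ y ∈ Finset.univ.erase r,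
        Δ y * pt y * ‖hbar_r‖ ^ 2 / (ptrj * ⟪hbar_r, hbar_j⟫)) :
    ⟪Δwr, hbar_r⟫ < 0 ↔ n j / n r > Dtil := by
  have hD : Dtil = S * ‖hbar_r‖ ^ 2 / (ptrj * ⟪hbar_r, hbar_j⟫) := by
    rw [hDtil, hS, Finset.sum_mul, Finset.sum_div]
  have hinner : ⟪Δwr, hbar_r⟫ =
      η * (S * ‖hbar_r‖ ^ 2 * n r - n j * (ptrj * ⟪hbar_r, hbar_j⟫)) := by
    rw [hΔwr, real_inner_smul_left, inner_sub_left, real_inner_smul_left,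
      real_inner_smul_left, real_inner_self_eq_norm_sq, real_inner_comm]
    ring
  rw [hD, hinner, gt_iff_lt, div_lt_div_iff₀ (mul_pos hptrj hdot) (hn r),
    ← sub_neg (b := n j * _)]
  exact ⟨fun h => neg_of_mul_neg_right h hη.le, fun h => mul_neg_of_pos_of_neg hη h⟩
end
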